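/- Let H be a commutative Hopf algebra over a field k and let A be a commutative unital k-algebra with a right partial coaction ρ̄: A → A ⊗ H (satisfying (PRHCA1), (PRHCA2), (PRHCA3)). For each k-algebra homomorphism g: H → k set 1_g := (id_A ⊗ g)(ρ̄(1_A)), θ_g := (id_A ⊗ g)∘ρ̄, and g⁻¹ := g∘S where S is the antipode. Then for every such g: (a) 1_g is an idempotent of A; (b) for every a ∈ A with a = 1_{g⁻¹}a one has θ_g(a) ∈ 1_g A; (c) θ_g(ab) = θ_g(a)θ_g(b) for all a, b ∈ 1_{g⁻¹}A; (d) θ_{g⁻¹}(θ_g(a)) = a for all a ∈ 1_{g⁻¹}A and θ_g(θ_{g⁻¹}(a)) = a for all a ∈ 1_g A; hence θ_g restricts to an algebra isomorphism from the unital ideal A_{g⁻¹} := 1_{g⁻¹}A onto A_g := 1_g A. -/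

import Mathlib

open TensorProduct

/-- A right partial coaction of a Hopf algebra `H` on a unital algebra `A`:
(PRHCA1) `ρ(ab) = ρ(a)ρ(b)`; (PRHCA2) `(id ⊗ ε)ρ(a) = a`;
(PRHCA3) `(ρ ⊗ id)ρ(a) = [(id ⊗ Δ)ρ(a)](ρ(1) ⊗ 1)`. -/
structure IsRightPartialCoaction (k : Type*) [Field k] {H A : Type*}
    [Ring H] [HopfAlgebra k H] [Ring A] [Algebra k A] (ρ : A →ₗ[k] A ⊗[k] H) : Prop where
  prhca1 : ∀ a b : A, ρ (a * b) = ρ a * ρ b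
  prhca2 : ∀ a : A,
    (TensorProduct.rid k A) ((TensorProduct.map LinearMap.id Coalgebra.counit) (ρ a)) = a
  prhca3 : ∀ a : A, (TensorProduct.map ρ LinearMap.id) (ρ a) =
    ((TensorProduct.assoc k A H H).symm
      ((TensorProduct.map LinearMap.id (Coalgebra.comul (R := k))) (ρ a))) * (ρ 1 ⊗ₜ[k] (1 : H))

/-- `(id_A ⊗ g) : A ⊗ H → A` for a functional `g : H → k`. -/
noncomputable def evR (k : Type*) [Field k] {A H : Type*} [AddCommGroup A] [Module k A]
    [AddCommGroup H] [Module k H] (g : H →ₗ[k] k) : A ⊗[k] H →ₗ[k] A :=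
  (TensorProduct.rid k A).toLinearMap ∘ₗ TensorProduct.map LinearMap.id g

/-- The idempotent `1_g = (id ⊗ g)(ρ(1_A))` associated to a partial coaction. -/
noncomputable def pUnit (k : Type*) [Field k] {H A : Type*}
    [Ring H] [HopfAlgebra k H] [Ring A] [Algebra k A]
    (ρ : A →ₗ[k] A ⊗[k] H) (g : H →ₗ[k] k) : A :=
  evR k g (ρ 1)

/-- The map `θ_g = (id ⊗ g) ∘ ρ` associated to a partial coaction. -/
noncomputable def pTheta (k : Type*) [Field k] {H A : Type*}
    [Ring H] [HopfAlgebra k H] [Ring A] [Algebra k A]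
    (ρ : A →ₗ[k] A ⊗[k] H) (g : H →ₗ[k] k) : A →ₗ[k] A :=
  evR k g ∘ₗ ρ

section EvR

variable {k H A : Type*} [Field k]

lemma evR_tmul [AddCommGroup A] [Module k A] [AddCommGroup H] [Module k H]
    (g : H →ₗ[k] k) (a : A) (h : H) : evR k g (a ⊗ₜ[k] h) = g h • a := by
  simp [evR]

lemma evR_mul [CommRing H] [Algebra k H] [CommRing A] [Algebra k A] {g : H →ₗ[k] k}
    (hg : ∀ x y : H, g (x * y) = g x * g y) (x y : A ⊗[k] H) :
    evR k g (x * y) = evR k g x * evR k g y := by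
  induction x with
  | zero => simp
  | add x₁ x₂ h₁ h₂ => simp only [add_mul, map_add, h₁, h₂]
  | tmul a h =>
    induction y with
    | zero => simp
    | add y₁ y₂ h₁ h₂ => simp only [mul_add, map_add, h₁, h₂]
    | tmul b h' =>
      simp only [Algebra.TensorProduct.tmul_mul_tmul, evR_tmul, hg, smul_mul_smul_comm]

lemma evR_map_id {B : Type*} [AddCommGroup A] [Module k A] [AddCommGroup B] [Module k B]
    [AddCommGroup H] [Module k H] (φ : A →ₗ[k] B) (g : H →ₗ[k] k) (x : A ⊗[k] H) :
    evR k g (TensorProduct.map φ LinearMap.id x) = φ (evR k g x) := by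
  induction x with
  | zero => simp
  | add x y hx hy => simp only [map_add, hx, hy]
  | tmul a h => simp [evR_tmul]

lemma evR_evR_assoc_symm [AddCommGroup A] [Module k A] [AddCommGroup H] [Module k H]
    (f g : H →ₗ[k] k) (a : A) (z : H ⊗[k] H) :
    evR k f (evR k g ((TensorProduct.assoc k A H H).symm (a ⊗ₜ[k] z))) =
      LinearMap.mul' k k (TensorProduct.map f g z) • a := by
  induction z with
  | zero => simp
  | add x y hx hy => simp only [TensorProduct.tmul_add, map_add, hx, hy, add_smul]
  | tmul x y => simp [evR_tmul, smul_smul, mul_comm]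

end EvR

section PartialCoaction

variable {k H A : Type*} [Field k] [CommRing H] [HopfAlgebra k H] [CommRing A] [Algebra k A]
  {ρ : A →ₗ[k] A ⊗[k] H}

lemma IsRightPartialCoaction.pTheta_mul (hρ : IsRightPartialCoaction k ρ) {g : H →ₗ[k] k}
    (hg : ∀ x y : H, g (x * y) = g x * g y) (a b : A) :
    pTheta k ρ g (a * b) = pTheta k ρ g a * pTheta k ρ g b := by
  simp [pTheta, hρ.prhca1, evR_mul hg]

lemma pTheta_one (g : H →ₗ[k] k) : pTheta k ρ g 1 = pUnit k ρ g := rfl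

/-- If `g` is a right convolution inverse of the character `f`, then `θ_f (θ_g a) = 1_f a`. -/
lemma IsRightPartialCoaction.pTheta_pTheta (hρ : IsRightPartialCoaction k ρ) {f g : H →ₗ[k] k}
    (hf : ∀ x y : H, f (x * y) = f x * f y)
    (hg : ∀ x y : H, g (x * y) = g x * g y) (hg1 : g 1 = 1)
    (hfg : ∀ h : H, LinearMap.mul' k k (TensorProduct.map f g (Coalgebra.comul (R := k) h)) =
      Coalgebra.counit (R := k) h) (a : A) :
    pTheta k ρ f (pTheta k ρ g a) = pUnit k ρ f * a := by
  have key (x : A ⊗[k] H) : evR k f (evR k g ((TensorProduct.assoc k A H H).symm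
      (TensorProduct.map LinearMap.id (Coalgebra.comul (R := k)) x))) =
      evR k (Coalgebra.counit (R := k)) x := by
    induction x with
    | zero => simp
    | add x y hx hy => simp only [map_add, hx, hy]
    | tmul a h =>
      rw [TensorProduct.map_tmul, evR_evR_assoc_symm, hfg, evR_tmul, LinearMap.id_apply]
  have h := congrArg (fun x => evR k f (evR k g x)) (hρ.prhca3 a)
  simp only [evR_map_id, evR_mul hg, evR_mul hf, key, evR_tmul, hg1, one_smul] at h
  have hcounit : evR k (Coalgebra.counit (R := k)) (ρ a) = a := hρ.prhca2 a
  rw [hcounit, mul_comm] at h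
  exact h

end PartialCoaction

lemma mul'_map_comp_antipode_left {k H : Type*} [Field k] [CommRing H] [HopfAlgebra k H]
    {g : H →ₗ[k] k} (hg1 : g 1 = 1) (hg : ∀ x y : H, g (x * y) = g x * g y) (h : H) :
    LinearMap.mul' k k (TensorProduct.map (g ∘ₗ HopfAlgebra.antipode (R := k)) g
      (Coalgebra.comul (R := k) h)) = Coalgebra.counit (R := k) h := by
  have key (z : H ⊗[k] H) : LinearMap.mul' k k
      (TensorProduct.map (g ∘ₗ HopfAlgebra.antipode (R := k)) g z) =
      g (LinearMap.mul' k H ((HopfAlgebra.antipode k).rTensor H z)) := by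
    induction z with
    | zero => simp
    | add x y hx hy => simp only [map_add, hx, hy]
    | tmul x y => simp [hg]
  rw [key, HopfAlgebra.mul_antipode_rTensor_comul_apply, Algebra.algebraMap_eq_smul_one, map_smul,
    hg1, smul_eq_mul, mul_one]

lemma mul'_map_comp_antipode_right {k H : Type*} [Field k] [CommRing H] [HopfAlgebra k H]
    {g : H →ₗ[k] k} (hg1 : g 1 = 1) (hg : ∀ x y : H, g (x * y) = g x * g y) (h : H) :
    LinearMap.mul' k k (TensorProduct.map g (g ∘ₗ HopfAlgebra.antipode (R := k))
      (Coalgebra.comul (R := k) h)) = Coalgebra.counit (R := k) h := by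
  have key (z : H ⊗[k] H) : LinearMap.mul' k k
      (TensorProduct.map g (g ∘ₗ HopfAlgebra.antipode (R := k)) z) =
      g (LinearMap.mul' k H ((HopfAlgebra.antipode k).lTensor H z)) := by
    induction z with
    | zero => simp
    | add x y hx hy => simp only [map_add, hx, hy]
    | tmul x y => simp [hg]
  rw [key, HopfAlgebra.mul_antipode_lTensor_comul_apply, Algebra.algebraMap_eq_smul_one, map_smul,
    hg1, smul_eq_mul, mul_one]

/-- For a right partial coaction of a commutative Hopf algebra `H` on a commutative algebra `A`
and an algebra homomorphism `g : H → k`, with `1_g := (id ⊗ g)(ρ(1))`, `θ_g := (id ⊗ g)∘ρ` and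
`g⁻¹ := g∘S`: (a) `1_g` is idempotent; (b) `θ_g` maps `1_{g⁻¹}A` into `1_g A`;
(c) `θ_g` is multiplicative on `1_{g⁻¹}A`; (d) `θ_{g⁻¹}∘θ_g = id` on `1_{g⁻¹}A` and
`θ_g∘θ_{g⁻¹} = id` on `1_g A`; hence `θ_g` restricts to an algebra isomorphism
`A_{g⁻¹} = 1_{g⁻¹}A → A_g = 1_g A`. -/
theorem pTheta_isom_of_partialCoaction
    {k H A : Type*} [Field k] [CommRing H] [HopfAlgebra k H] [CommRing A] [Algebra k A]
    (ρ : A →ₗ[k] A ⊗[k] H) (hρ : IsRightPartialCoaction k ρ)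
    (g : H →ₗ[k] k) (hg1 : g 1 = 1) (hgmul : ∀ x y : H, g (x * y) = g x * g y) :
    -- (a) `1_g` is an idempotent of `A`:
    (pUnit k ρ g * pUnit k ρ g = pUnit k ρ g) ∧
    -- (b) `θ_g(a) ∈ 1_g A` for every `a ∈ 1_{g⁻¹}A`:
    (∀ a : A, pUnit k ρ (g ∘ₗ HopfAlgebra.antipode (R := k)) * a = a →
      pUnit k ρ g * pTheta k ρ g a = pTheta k ρ g a) ∧
    -- (c) `θ_g` is multiplicative on `1_{g⁻¹}A`:
    (∀ a b : A, pUnit k ρ (g ∘ₗ HopfAlgebra.antipode (R := k)) * a = a →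
      pUnit k ρ (g ∘ₗ HopfAlgebra.antipode (R := k)) * b = b →
      pTheta k ρ g (a * b) = pTheta k ρ g a * pTheta k ρ g b) ∧
    -- (d) `θ_{g⁻¹}` is inverse to `θ_g` on the respective ideals:
    (∀ a : A, pUnit k ρ (g ∘ₗ HopfAlgebra.antipode (R := k)) * a = a →
      pTheta k ρ (g ∘ₗ HopfAlgebra.antipode (R := k)) (pTheta k ρ g a) = a) ∧
    (∀ a : A, pUnit k ρ g * a = a →
      pTheta k ρ g (pTheta k ρ (g ∘ₗ HopfAlgebra.antipode (R := k)) a) = a) := by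
  have hS1 : (g ∘ₗ HopfAlgebra.antipode (R := k)) 1 = 1 := by simp [hg1]
  have hS (x y : H) : (g ∘ₗ HopfAlgebra.antipode (R := k)) (x * y) =
      (g ∘ₗ HopfAlgebra.antipode (R := k)) x * (g ∘ₗ HopfAlgebra.antipode (R := k)) y := by
    simp [HopfAlgebra.antipode_mul_distrib, hgmul]
  refine ⟨?_, fun a _ => ?_, fun a b _ _ => hρ.pTheta_mul hgmul a b, fun a ha => ?_,
    fun a ha => ?_⟩
  · rw [← pTheta_one, ← hρ.pTheta_mul hgmul, one_mul]
  · rw [← pTheta_one, ← hρ.pTheta_mul hgmul, one_mul]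
  · rw [hρ.pTheta_pTheta hS hgmul hg1 (mul'_map_comp_antipode_left hg1 hgmul), ha]
  · rw [hρ.pTheta_pTheta hgmul hS hS1 (mul'_map_comp_antipode_right hg1 hgmul), ha]
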